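/- arXiv:2311.06109 — 2 statements merged into one kernel-verified Lean document; each statement's English description precedes it below -/
import Mathlib

section
/- A pseudo-Kleene lattice A is sp-orthomodular if and only if for all x, y in A with x ≤ y, the elements x ∨ (y ∧ y') and y ∧ (x ∨ x') generate a Boolean subalgebra of the localizer Local(x, y); that is, there exists a subset S of [0_{x,y}, 1_{x,y}] containing 0_{x,y}, 1_{x,y}, x ∨ (y ∧ y') and y ∧ (x ∨ x'), closed under ∧, ∨ and ', distributive, and such that z ∧ z' = 0_{x,y} for every z in S. -/
theorem inv_sup_aux {α : Type*} [Lattice α] (inv : α → α)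
    (hanti : ∀ x y : α, x ≤ y → inv y ≤ inv x)
    (hinv : ∀ x : α, inv (inv x) = x) (x y : α) : inv (x ⊔ y) = inv x ⊓ inv y := by
  apply le_antisymm
  · exact le_inf (hanti _ _ le_sup_left) (hanti _ _ le_sup_right)
  · have h : x ⊔ y ≤ inv (inv x ⊓ inv y) := by
      apply sup_le
      · have := hanti _ _ (inf_le_left : inv x ⊓ inv y ≤ inv x)
        rwa [hinv] at this
      · have := hanti _ _ (inf_le_right : inv x ⊓ inv y ≤ inv y)
        rwa [hinv] at this
    have := hanti _ _ h
    rwa [hinv] at this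

theorem inv_inf_aux {α : Type*} [Lattice α] (inv : α → α)
    (hanti : ∀ x y : α, x ≤ y → inv y ≤ inv x)
    (hinv : ∀ x : α, inv (inv x) = x) (x y : α) : inv (x ⊓ y) = inv x ⊔ inv y := by
  have := inv_sup_aux inv hanti hinv (inv x) (inv y)
  rw [hinv, hinv] at this
  rw [← this, hinv]

/-- Join of the selected atoms. -/
def atomJoin {α : Type*} [Lattice α] (o a c b : α) (u : Bool × Bool × Bool) : α :=
  (if u.1 then a else o) ⊔ ((if u.2.1 then c else o) ⊔ (if u.2.2 then b else o))

theorem boolean_aux {α : Type*} [Lattice α] (inv : α → α)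
    (hanti : ∀ x y : α, x ≤ y → inv y ≤ inv x)
    (hinv : ∀ x : α, inv (inv x) = x) (o a c b : α)
    (hoa : o ≤ a) (hoc : o ≤ c) (hob : o ≤ b)
    (ha : inv a = c ⊔ b) (hc : inv c = a ⊔ b) (hb : inv b = a ⊔ c)
    (ho : inv o = a ⊔ (c ⊔ b)) :
    ∃ S : Set α, S ⊆ Set.Icc o (inv o) ∧ o ∈ S ∧ inv o ∈ S ∧ a ∈ S ∧ inv b ∈ S ∧
      (∀ a ∈ S, ∀ b ∈ S, a ⊓ b ∈ S) ∧ (∀ a ∈ S, ∀ b ∈ S, a ⊔ b ∈ S) ∧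
      (∀ a ∈ S, inv a ∈ S) ∧
      (∀ a ∈ S, ∀ b ∈ S, ∀ d ∈ S, a ⊓ (b ⊔ d) = (a ⊓ b) ⊔ (a ⊓ d)) ∧
      (∀ z ∈ S, z ⊓ inv z = o) := by
  have ha' : inv (c ⊔ b) = a := by rw [← ha, hinv]
  have hc' : inv (a ⊔ b) = c := by rw [← hc, hinv]
  have hb' : inv (a ⊔ c) = b := by rw [← hb, hinv]
  have ho' : inv (a ⊔ (c ⊔ b)) = o := by rw [← ho, hinv]
  have hocb : o ≤ c ⊔ b := hoc.trans le_sup_left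
  have hS : ∀ u v, atomJoin o a c b (u ⊔ v) = atomJoin o a c b u ⊔ atomJoin o a c b v := by
    have key : ∀ (e : α), o ≤ e → ∀ p q : Bool, (if (p ⊔ q) = true then e else o) =
        (if p = true then e else o) ⊔ (if q = true then e else o) := by
      intro e he p q
      cases p <;> cases q <;> simp [he]
    rintro ⟨u1, u2, u3⟩ ⟨v1, v2, v3⟩
    simp only [atomJoin, Prod.mk_sup_mk]
    rw [key a hoa, key c hoc, key b hob, sup_sup_sup_comm (if u2 = true then c else o),
      sup_sup_sup_comm (if u1 = true then a else o)]
  have hC : ∀ u, atomJoin o a c b uᶜ = inv (atomJoin o a c b u) := by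
    rintro ⟨u1, u2, u3⟩
    cases u1 <;> cases u2 <;> cases u3 <;>
      simp [atomJoin, hoa, hoc, hob, hocb, sup_eq_right.2 hocb, ha, hb, hc, ho, ha', hb', hc', ho']
  have hI : ∀ u v, atomJoin o a c b (u ⊓ v) = atomJoin o a c b u ⊓ atomJoin o a c b v := by
    intro u v
    rw [← compl_compl (u ⊓ v), hC, compl_inf, hS, inv_sup_aux inv hanti hinv, hC, hC, hinv, hinv]
  have hbot : atomJoin o a c b (false, false, false) = o := by simp [atomJoin]
  have htop : ∀ u, o ≤ atomJoin o a c b u := by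
    intro u
    have : u = u ⊔ (false, false, false) := by revert u; decide
    rw [this, hS, hbot]
    exact le_sup_right
  refine ⟨Set.range (atomJoin o a c b), ?_, ⟨_, hbot⟩, ?_, ?_, ?_, ?_, ?_, ?_, ?_, ?_⟩
  · rintro _ ⟨u, rfl⟩
    refine ⟨htop u, ?_⟩
    have := hanti _ _ (htop uᶜ)
    rwa [hC, hinv] at this
  · exact ⟨_, (hC _).trans (congrArg inv hbot)⟩
  · exact ⟨(true, false, false), by simp [atomJoin, hoa]⟩
  · exact ⟨(true, true, false), by simp [atomJoin, hoc, hb]⟩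
  · rintro _ ⟨u, rfl⟩ _ ⟨v, rfl⟩
    exact ⟨_, hI u v⟩
  · rintro _ ⟨u, rfl⟩ _ ⟨v, rfl⟩
    exact ⟨_, hS u v⟩
  · rintro _ ⟨u, rfl⟩
    exact ⟨_, hC u⟩
  · rintro _ ⟨u, rfl⟩ _ ⟨v, rfl⟩ _ ⟨w, rfl⟩
    rw [← hS, ← hI, ← hI, ← hI, ← hS, inf_sup_left]
  · rintro _ ⟨u, rfl⟩
    rw [← hC, ← hI, inf_compl_self]
    exact hbot

theorem sp_aux {α : Type*} [Lattice α] (inv : α → α)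
    (hanti : ∀ x y : α, x ≤ y → inv y ≤ inv x)
    (hinv : ∀ x : α, inv (inv x) = x)
    (h1 : ∀ x y : α, x ≤ y → inv x ⊓ y = (x ⊓ inv x) ⊔ (y ⊓ inv y) →
        y ⊓ (x ⊔ inv x) = x ⊔ (y ⊓ inv y))
    (o a b : α) (hab : a ≤ b) (ha : a ⊓ inv a = o) (hb : b ⊓ inv b = o)
    (hc : (b ⊓ inv a) ⊓ inv (b ⊓ inv a) = o) : a ⊔ (b ⊓ inv a) = b := by
  have hS := inv_sup_aux inv hanti hinv
  have hoa : o ≤ a := ha ▸ inf_le_left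
  have hob : o ≤ inv b := hb ▸ inf_le_right
  have hxb : a ⊔ (b ⊓ inv a) ≤ b := sup_le hab inf_le_left
  have e1 : inv (a ⊔ (b ⊓ inv a)) ⊓ b = o := by
    rw [hS, ← hc]
    ac_rfl
  have e2 : (a ⊔ (b ⊓ inv a)) ⊓ inv (a ⊔ (b ⊓ inv a)) = o := by
    apply le_antisymm
    · rw [← e1]
      exact le_inf inf_le_right (inf_le_left.trans hxb)
    · exact le_inf (hoa.trans le_sup_left) (hob.trans (hanti _ _ hxb))
  have e3 : b ≤ (a ⊔ (b ⊓ inv a)) ⊔ inv (a ⊔ (b ⊓ inv a)) := by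
    have : inv o = (a ⊔ (b ⊓ inv a)) ⊔ inv (a ⊔ (b ⊓ inv a)) := by
      conv_lhs => rw [← e2]
      rw [inv_inf_aux inv hanti hinv, hinv, sup_comm]
    rw [← this]
    have := hanti _ _ hob
    rwa [hinv] at this
  have := h1 _ _ hxb (by rw [e1, e2, hb, sup_idem])
  rw [inf_eq_left.2 e3, hb, sup_eq_left.2 (hoa.trans le_sup_left)] at this
  exact this.symm

/-- A pseudo-Kleene lattice is sp-orthomodular iff for all x ≤ y,
the elements x ∨ (y ∧ y') and y ∧ (x ∨ x') generate a Boolean subalgebra of the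
localizer Local(x,y). -/
theorem stmt_13 {α : Type*} [Lattice α] [BoundedOrder α] (inv : α → α)
    (hanti : ∀ x y : α, x ≤ y → inv y ≤ inv x)
    (hinv : ∀ x : α, inv (inv x) = x)
    (hkle : ∀ x y : α, x ⊓ inv x ≤ y ⊔ inv y) :
    ((∀ x y : α, x ≤ y → inv x ⊓ y = (x ⊓ inv x) ⊔ (y ⊓ inv y) →
        y ⊓ (x ⊔ inv x) = x ⊔ (y ⊓ inv y)) ∧
     (∀ x y : α, x ≤ y →
        (x ⊓ inv x) ⊔ (y ⊓ inv y) = (inv x ⊓ y) ⊓ inv (inv x ⊓ y))) ↔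
    (∀ x y : α, x ≤ y → ∃ S : Set α,
      S ⊆ Set.Icc ((x ⊓ inv x) ⊔ (y ⊓ inv y)) ((x ⊔ inv x) ⊓ (y ⊔ inv y)) ∧
      (x ⊓ inv x) ⊔ (y ⊓ inv y) ∈ S ∧
      (x ⊔ inv x) ⊓ (y ⊔ inv y) ∈ S ∧
      x ⊔ (y ⊓ inv y) ∈ S ∧
      y ⊓ (x ⊔ inv x) ∈ S ∧
      (∀ a ∈ S, ∀ b ∈ S, a ⊓ b ∈ S) ∧ (∀ a ∈ S, ∀ b ∈ S, a ⊔ b ∈ S) ∧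
      (∀ a ∈ S, inv a ∈ S) ∧
      (∀ a ∈ S, ∀ b ∈ S, ∀ d ∈ S, a ⊓ (b ⊔ d) = (a ⊓ b) ⊔ (a ⊓ d)) ∧
      (∀ z ∈ S, z ⊓ inv z = (x ⊓ inv x) ⊔ (y ⊓ inv y))) := by
  have hS := inv_sup_aux inv hanti hinv
  have hI := inv_inf_aux inv hanti hinv
  have hmeet : ∀ x y : α, (y ⊓ (x ⊔ inv x)) ⊓ inv (x ⊔ (y ⊓ inv y)) = inv x ⊓ y := by
    intro x y
    rw [hS, hI, hinv]
    apply le_antisymm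
    · exact le_inf (inf_le_right.trans inf_le_left) (inf_le_left.trans inf_le_left)
    · exact le_inf (le_inf inf_le_right (inf_le_left.trans le_sup_right))
        (le_inf inf_le_left (inf_le_right.trans le_sup_right))
  have hone : ∀ x y : α, (x ⊔ inv x) ⊓ (y ⊔ inv y) = inv ((x ⊓ inv x) ⊔ (y ⊓ inv y)) := by
    intro x y
    rw [hS, hI, hI, hinv, hinv, sup_comm x, sup_comm y]
  constructor
  · rintro ⟨h1, h2⟩ x y hxy
    have h2' := h2 x y hxy
    rw [hI, hinv] at h2'
    have hyx := hanti _ _ hxy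
    have ha : (x ⊔ (y ⊓ inv y)) ⊓ inv (x ⊔ (y ⊓ inv y)) = (x ⊓ inv x) ⊔ (y ⊓ inv y) := by
      apply le_antisymm
      · rw [h2', hS]
        refine le_inf (le_inf (inf_le_right.trans inf_le_left)
          (inf_le_left.trans (sup_le hxy inf_le_left))) (inf_le_left.trans ?_)
        exact sup_le le_sup_left (inf_le_right.trans le_sup_right)
      · rw [hS, hI, hinv]
        refine sup_le (le_inf (inf_le_left.trans le_sup_left) (le_inf inf_le_right ?_))
          (le_inf le_sup_right (le_inf (inf_le_right.trans hyx) (inf_le_left.trans le_sup_right)))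
        exact inf_le_left.trans (hxy.trans le_sup_right)
    have hb : (y ⊓ (x ⊔ inv x)) ⊓ inv (y ⊓ (x ⊔ inv x)) = (x ⊓ inv x) ⊔ (y ⊓ inv y) := by
      apply le_antisymm
      · rw [h2', hI, hS, hinv]
        refine le_inf (le_inf (inf_le_right.trans (sup_le hyx inf_le_left))
          (inf_le_left.trans inf_le_left)) (inf_le_right.trans ?_)
        exact sup_le le_sup_right (inf_le_right.trans le_sup_left)
      · rw [hI, hS, hinv]
        refine sup_le (le_inf (le_inf (inf_le_left.trans hxy) (inf_le_left.trans le_sup_left)) ?_)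
          (le_inf (le_inf inf_le_left (hkle y x)) (inf_le_right.trans le_sup_left))
        exact (le_of_eq (inf_comm _ _)).trans le_sup_right
    have hc : ((y ⊓ (x ⊔ inv x)) ⊓ inv (x ⊔ (y ⊓ inv y))) ⊓
        inv ((y ⊓ (x ⊔ inv x)) ⊓ inv (x ⊔ (y ⊓ inv y))) = (x ⊓ inv x) ⊔ (y ⊓ inv y) := by
      rw [hmeet, h2 x y hxy]
    have hab : x ⊔ (y ⊓ inv y) ≤ y ⊓ (x ⊔ inv x) :=
      sup_le (le_inf hxy le_sup_left) (le_inf inf_le_left (hkle y x))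
    rw [hone]
    generalize x ⊔ (y ⊓ inv y) = a at *
    generalize y ⊓ (x ⊔ inv x) = b at *
    generalize (x ⊓ inv x) ⊔ (y ⊓ inv y) = o at *
    have k1 := sp_aux inv hanti hinv h1 o a b hab ha hb hc
    have k2 := sp_aux inv hanti hinv h1 o (inv b) (inv a) (hanti _ _ hab)
      (by rw [hinv, inf_comm, hb]) (by rw [hinv, inf_comm, ha])
      (by rw [hinv, inf_comm (inv a), hc])
    rw [hinv, inf_comm (inv a)] at k2
    have := boolean_aux inv hanti hinv o a (b ⊓ inv a) (inv b)
      (ha ▸ inf_le_left) (hc ▸ inf_le_left) (hb ▸ inf_le_right)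
      (by rw [sup_comm, k2]) (by rw [hI, hinv, sup_comm]) (by rw [hinv, k1])
      (by rw [← sup_assoc, k1, ← hb, hI, hinv, sup_comm])
    rwa [hinv] at this
  · intro h
    constructor
    · intro x y hxy hc
      obtain ⟨S, hsub, -, -, haS, hbS, -, -, hinvS, hd, hz⟩ := h x y hxy
      have e := hd _ hbS _ haS _ (hinvS _ haS)
      have hza := congrArg inv (hz _ haS)
      rw [hI, hinv, sup_comm, ← hone] at hza
      have hab : x ⊔ (y ⊓ inv y) ≤ y ⊓ (x ⊔ inv x) :=
        sup_le (le_inf hxy le_sup_left) (le_inf inf_le_left (hkle y x))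
      rw [hmeet, hc, hza, inf_eq_left.2 (hsub hbS).2, inf_eq_right.2 hab,
        sup_eq_left.2 (hsub haS).1] at e
      exact e
    · intro x y hxy
      obtain ⟨S, -, -, -, haS, hbS, hm, -, hinvS, -, hz⟩ := h x y hxy
      have := hz _ (hm _ hbS _ (hinvS _ haS))
      rw [hmeet] at this
      exact this.symm
end

section
/- Let A be a modular pseudo-Kleene lattice and x, y elements of A. Then x C y if and only if the subalgebra of A generated by x and y is a Kleene lattice; equivalently, x C y if and only if there exists a distributive subalgebra of A containing both x and y. -/
/-- Commutativity in a pseudo-Kleene lattice: conditions (C1), (C2), (C3). -/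
def PKLComm {α : Type*} [Lattice α] (inv : α → α) (x y : α) : Prop :=
  x ⊓ (y ⊔ inv y) = (x ⊓ y) ⊔ (x ⊓ inv y) ∧
  y ⊓ (x ⊔ inv x) = (y ⊓ x) ⊔ (y ⊓ inv x) ∧
  x ⊓ inv x = ((x ⊓ inv x) ⊓ y) ⊔ ((x ⊓ inv x) ⊓ inv y)

section Aux
variable {α : Type*} [Lattice α]

def LMod (α : Type*) [Lattice α] : Prop :=
  ∀ x y z : α, x ≤ z → x ⊔ (y ⊓ z) = (x ⊔ y) ⊓ z

theorem d_to_ds (hm : LMod α) {a b c : α} (h : a ⊓ (b ⊔ c) = (a ⊓ b) ⊔ (a ⊓ c)) :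
    b ⊔ (a ⊓ c) = (b ⊔ a) ⊓ (b ⊔ c) := by
  rw [← hm b a (b ⊔ c) le_sup_left, h, ← sup_assoc]
  congr 1
  exact (sup_eq_left.2 inf_le_right).symm

theorem ds_to_d (hm : LMod α) {a b c : α} (h : a ⊔ (b ⊓ c) = (a ⊔ b) ⊓ (a ⊔ c)) :
    b ⊓ (a ⊔ c) = (b ⊓ a) ⊔ (b ⊓ c) := by
  have h1 := hm (b ⊓ c) a b inf_le_left
  have h2 : (b ⊓ a) ⊔ (b ⊓ c) = ((b ⊓ c) ⊔ a) ⊓ b := by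
    rw [← h1, sup_comm, inf_comm a b]
  rw [h2, sup_comm (b ⊓ c) a, h]
  apply le_antisymm
  · exact le_inf (le_inf (inf_le_left.trans le_sup_right) inf_le_right) inf_le_left
  · exact le_inf inf_le_right (inf_le_left.trans inf_le_right)

/-- rotate -/
theorem d_rot (hm : LMod α) {a b c : α} (h : a ⊓ (b ⊔ c) = (a ⊓ b) ⊔ (a ⊓ c)) :
    c ⊓ (a ⊔ b) = (c ⊓ a) ⊔ (c ⊓ b) := by
  have h1 := d_to_ds hm h
  rw [inf_comm a c, inf_comm (b ⊔ a)] at h1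
  have := ds_to_d hm h1
  rw [sup_comm a b, this, sup_comm]

/-- full dual -/
theorem d_dual (hm : LMod α) {a b c : α} (h : a ⊓ (b ⊔ c) = (a ⊓ b) ⊔ (a ⊓ c)) :
    a ⊔ (b ⊓ c) = (a ⊔ b) ⊓ (a ⊔ c) := by
  have := d_to_ds hm (d_rot hm (d_rot hm h))
  have h2 := d_to_ds hm (d_rot hm h)
  rw [inf_comm b c, h2, inf_comm]

theorem ds_dual (hm : LMod α) {a b c : α} (h : a ⊔ (b ⊓ c) = (a ⊔ b) ⊓ (a ⊔ c)) :
    a ⊓ (b ⊔ c) = (a ⊓ b) ⊔ (a ⊓ c) := by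
  have := d_rot hm (ds_to_d hm h)
  have h2 := d_rot hm this
  rw [sup_comm b c, sup_comm (a ⊓ b)]
  first
    | exact this
    | exact h2

theorem d_comp {a b c : α} (h : a ≤ b ∨ b ≤ a) : c ⊓ (a ⊔ b) = (c ⊓ a) ⊔ (c ⊓ b) := by
  rcases h with h | h
  · rw [sup_eq_right.2 h, sup_eq_right.2 (inf_le_inf_left c h)]
  · rw [sup_eq_left.2 h, sup_eq_left.2 (inf_le_inf_left c h)]

variable [BoundedOrder α]

structure GoodS (S : Set α) : Prop where
  bot : (⊥ : α) ∈ S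
  top : (⊤ : α) ∈ S
  inf : ∀ a ∈ S, ∀ b ∈ S, a ⊓ b ∈ S
  sup : ∀ a ∈ S, ∀ b ∈ S, a ⊔ b ∈ S
  dist : ∀ a ∈ S, ∀ b ∈ S, ∀ d ∈ S, a ⊓ (b ⊔ d) = (a ⊓ b) ⊔ (a ⊓ d)

theorem ext_step (hm : LMod α) {K : Set α} (hK : GoodS K) (c : α)
    (hc : ∀ a ∈ K, ∀ b ∈ K, c ⊓ (a ⊔ b) = (c ⊓ a) ⊔ (c ⊓ b)) :
    ∃ S : Set α, GoodS S ∧ K ⊆ S ∧ c ∈ S ∧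
      ∀ u ∈ S, ∃ a ∈ K, ∃ b ∈ K, b ≤ a ∧ u = (c ⊓ a) ⊔ b := by
  have hsup : ∀ a₁ ∈ K, ∀ b₁ ∈ K, ∀ a₂ ∈ K, ∀ b₂ ∈ K,
      ((c ⊓ a₁) ⊔ b₁) ⊔ ((c ⊓ a₂) ⊔ b₂) = (c ⊓ (a₁ ⊔ a₂)) ⊔ (b₁ ⊔ b₂) := by
    intro a₁ h1 b₁ _ a₂ h2 b₂ _
    rw [hc a₁ h1 a₂ h2]
    ac_rfl
  have alt : ∀ a b : α, b ≤ a → (c ⊓ a) ⊔ b = (b ⊔ c) ⊓ a := by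
    intro a b h
    rw [← hm b c a h, sup_comm]
  have hinf : ∀ a₁ ∈ K, ∀ b₁ ∈ K, ∀ a₂ ∈ K, ∀ b₂ ∈ K, b₁ ≤ a₁ → b₂ ≤ a₂ →
      ((c ⊓ a₁) ⊔ b₁) ⊓ ((c ⊓ a₂) ⊔ b₂) = (c ⊓ (a₁ ⊓ a₂)) ⊔ (b₁ ⊓ b₂) := by
    intro a₁ _ b₁ g1 a₂ _ b₂ g2 l1 l2
    rw [alt _ _ l1, alt _ _ l2, alt _ _ (inf_le_inf l1 l2), sup_comm (b₁ ⊓ b₂) c,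
      d_dual hm (hc b₁ g1 b₂ g2), sup_comm c b₁, sup_comm c b₂]
    ac_rfl
  refine ⟨{u | ∃ a ∈ K, ∃ b ∈ K, b ≤ a ∧ u = (c ⊓ a) ⊔ b}, ⟨?_, ?_, ?_, ?_, ?_⟩, ?_, ?_, ?_⟩
  · exact ⟨⊥, hK.bot, ⊥, hK.bot, le_rfl, by simp⟩
  · exact ⟨⊤, hK.top, ⊤, hK.top, le_rfl, by simp⟩
  · rintro _ ⟨a₁, h1, b₁, g1, l1, rfl⟩ _ ⟨a₂, h2, b₂, g2, l2, rfl⟩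
    exact ⟨_, hK.inf _ h1 _ h2, _, hK.inf _ g1 _ g2, inf_le_inf l1 l2,
      hinf _ h1 _ g1 _ h2 _ g2 l1 l2⟩
  · rintro _ ⟨a₁, h1, b₁, g1, l1, rfl⟩ _ ⟨a₂, h2, b₂, g2, l2, rfl⟩
    exact ⟨_, hK.sup _ h1 _ h2, _, hK.sup _ g1 _ g2, sup_le_sup l1 l2,
      hsup _ h1 _ g1 _ h2 _ g2⟩
  · rintro _ ⟨a₁, h1, b₁, g1, l1, rfl⟩ _ ⟨a₂, h2, b₂, g2, l2, rfl⟩ _ ⟨a₃, h3, b₃, g3, l3, rfl⟩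
    rw [hsup _ h2 _ g2 _ h3 _ g3,
      hinf _ h1 _ g1 _ (hK.sup _ h2 _ h3) _ (hK.sup _ g2 _ g3) l1 (sup_le_sup l2 l3),
      hinf _ h1 _ g1 _ h2 _ g2 l1 l2, hinf _ h1 _ g1 _ h3 _ g3 l1 l3,
      hsup _ (hK.inf _ h1 _ h2) _ (hK.inf _ g1 _ g2) _ (hK.inf _ h1 _ h3) _ (hK.inf _ g1 _ g3),
      hK.dist _ h1 _ h2 _ h3, hK.dist _ g1 _ g2 _ g3]
  · intro k hk
    exact ⟨k, hk, k, hk, le_rfl, (sup_eq_right.2 inf_le_right).symm⟩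
  · exact ⟨⊤, hK.top, ⊥, hK.bot, bot_le, by simp⟩
  · exact fun u hu => hu

theorem two_gen (hm : LMod α) (x z : α) : ∃ K : Set α, GoodS K ∧ x ∈ K ∧ z ∈ K ∧
    ∀ u ∈ K, u = ⊥ ∨ u = x ⊓ z ∨ u = x ∨ u = z ∨ u = x ⊔ z ∨ u = ⊤ := by
  have h0 : GoodS ({⊥, ⊤} : Set α) := by
    constructor <;> simp
  obtain ⟨K1, g1, s1, m1, e1⟩ := ext_step hm h0 x (by simp)
  have e1' : ∀ u ∈ K1, u = ⊥ ∨ u = x ∨ u = ⊤ := by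
    intro u hu
    obtain ⟨a, ha, b, hb, -, rfl⟩ := e1 u hu
    rcases ha with rfl | rfl <;> rcases hb with rfl | rfl <;> simp
  obtain ⟨K2, g2, s2, m2, e2⟩ := ext_step hm g1 z (by
    intro a ha b hb
    apply d_comp
    rcases e1' a ha with rfl | rfl | rfl <;> rcases e1' b hb with rfl | rfl | rfl <;> simp)
  refine ⟨K2, g2, s2 m1, m2, ?_⟩
  intro u hu
  obtain ⟨a, ha, b, hb, hl, rfl⟩ := e2 u hu
  rcases e1' a ha with rfl | rfl | rfl <;> rcases e1' b hb with rfl | rfl | rfl <;>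
    simp [inf_comm, sup_comm]

theorem four_gen (hm : LMod α) (x z y w : α)
    (hy : y ⊓ (x ⊔ z) = (y ⊓ x) ⊔ (y ⊓ z))
    (hw : w ⊓ (x ⊔ z) = (w ⊓ x) ⊔ (w ⊓ z))
    (hq : (y ⊓ w) ⊓ (x ⊔ z) = ((y ⊓ w) ⊓ x) ⊔ ((y ⊓ w) ⊓ z))
    (hx : x ⊓ (y ⊔ w) = (x ⊓ y) ⊔ (x ⊓ w))
    (hz : z ⊓ (y ⊔ w) = (z ⊓ y) ⊔ (z ⊓ w))
    (hp : (x ⊓ z) ⊓ (y ⊔ w) = ((x ⊓ z) ⊓ y) ⊔ ((x ⊓ z) ⊓ w))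
    (hp' : (x ⊔ z) ⊓ (y ⊔ w) = ((x ⊔ z) ⊓ y) ⊔ ((x ⊔ z) ⊓ w)) :
    ∃ K : Set α, GoodS K ∧ x ∈ K ∧ z ∈ K ∧ y ∈ K ∧ w ∈ K := by
  obtain ⟨K, g, mx, mz, e⟩ := two_gen hm x z
  have key : ∀ c : α, c ⊓ (x ⊔ z) = (c ⊓ x) ⊔ (c ⊓ z) →
      ∀ a ∈ K, ∀ b ∈ K, c ⊓ (a ⊔ b) = (c ⊓ a) ⊔ (c ⊓ b) := by
    intro c hc a ha b hb
    have l1 : x ⊓ z ≤ x ⊔ z := inf_le_left.trans le_sup_left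
    by_cases hcomp : a ≤ b ∨ b ≤ a
    · exact d_comp hcomp
    rcases e a ha with rfl | rfl | rfl | rfl | rfl | rfl <;>
      rcases e b hb with rfl | rfl | rfl | rfl | rfl | rfl <;>
      first
        | exact hc
        | (exfalso; apply hcomp; simp [l1]; done)
        | (rw [sup_comm, hc, sup_comm]; done)
  have H2 : ∀ b ∈ K, b ⊓ (y ⊔ w) = (b ⊓ y) ⊔ (b ⊓ w) := by
    intro b hb
    rcases e b hb with rfl | rfl | rfl | rfl | rfl | rfl
    · simp
    · exact hp
    · exact hx
    · exact hz
    · exact hp'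
    · simp
  obtain ⟨K2, g2, s2, my, e2⟩ := ext_step hm g y (key y hy)
  have star : ∀ a ∈ K, ∀ b ∈ K, b ≤ a → w ⊓ ((y ⊓ a) ⊔ b) = ((y ⊓ w) ⊓ a) ⊔ (w ⊓ b) := by
    intro a _ b hb hl
    have h1 : b ⊓ (w ⊔ (y ⊓ a)) = (b ⊓ w) ⊔ (b ⊓ (y ⊓ a)) := by
      have h3 : b ⊓ (y ⊓ a) = b ⊓ y := by
        rw [inf_comm y a, ← inf_assoc, inf_eq_left.2 hl]
      apply le_antisymm
      · rw [h3, sup_comm (b ⊓ w), ← H2 b hb]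
        exact inf_le_inf_left _ (sup_le le_sup_right (inf_le_left.trans le_sup_left))
      · exact sup_le (inf_le_inf_left _ le_sup_left) (inf_le_inf_left _ le_sup_right)
    have h2 := d_rot hm (d_rot hm h1)
    rw [h2]
    congr 1
    ac_rfl
  obtain ⟨K3, g3, s3, mw, -⟩ := ext_step hm g2 w (by
    intro u hu v hv
    obtain ⟨a₁, h1, b₁, g1, l1, rfl⟩ := e2 u hu
    obtain ⟨a₂, h2, b₂, g2, l2, rfl⟩ := e2 v hv
    have : ((y ⊓ a₁) ⊔ b₁) ⊔ ((y ⊓ a₂) ⊔ b₂) = (y ⊓ (a₁ ⊔ a₂)) ⊔ (b₁ ⊔ b₂) := by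
      rw [key y hy a₁ h1 a₂ h2]
      ac_rfl
    rw [this, star _ (g.sup _ h1 _ h2) _ (g.sup _ g1 _ g2) (sup_le_sup l1 l2),
      star _ h1 _ g1 l1, star _ h2 _ g2 l2, key _ hq _ h1 _ h2, key _ hw _ g1 _ g2]
    ac_rfl)
  exact ⟨K3, g3, s3 (s2 mx), s3 (s2 mz), s3 my, mw⟩

end Aux

/-- In a modular pseudo-Kleene lattice, x C y iff there is a
distributive subalgebra (a Kleene sublattice) containing both x and y. -/
theorem stmt_19 {α : Type*} [Lattice α] [BoundedOrder α] (inv : α → α)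
    (hanti : ∀ x y : α, x ≤ y → inv y ≤ inv x)
    (hinv : ∀ x : α, inv (inv x) = x)
    (hkle : ∀ x y : α, x ⊓ inv x ≤ y ⊔ inv y)
    (hmod : ∀ x y z : α, x ≤ z → x ⊔ (y ⊓ z) = (x ⊔ y) ⊓ z)
    (x y : α) :
    PKLComm inv x y ↔
    (∃ S : Set α, x ∈ S ∧ y ∈ S ∧ (⊥ : α) ∈ S ∧ (⊤ : α) ∈ S ∧
      (∀ a ∈ S, ∀ b ∈ S, a ⊓ b ∈ S) ∧ (∀ a ∈ S, ∀ b ∈ S, a ⊔ b ∈ S) ∧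
      (∀ a ∈ S, inv a ∈ S) ∧
      (∀ a ∈ S, ∀ b ∈ S, ∀ d ∈ S, a ⊓ (b ⊔ d) = (a ⊓ b) ⊔ (a ⊓ d))) := by
  have hm : LMod α := hmod
  have isup : ∀ a b, inv (a ⊔ b) = inv a ⊓ inv b := by
    intro a b
    apply le_antisymm
    · exact le_inf (hanti _ _ le_sup_left) (hanti _ _ le_sup_right)
    · have : a ⊔ b ≤ inv (inv a ⊓ inv b) := by
        apply sup_le
        · have := hanti _ _ (inf_le_left : inv a ⊓ inv b ≤ inv a)
          rwa [hinv] at this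
        · have := hanti _ _ (inf_le_right : inv a ⊓ inv b ≤ inv b)
          rwa [hinv] at this
      have := hanti _ _ this
      rwa [hinv] at this
  have iinf : ∀ a b, inv (a ⊓ b) = inv a ⊔ inv b := by
    intro a b
    have := isup (inv a) (inv b)
    rw [hinv, hinv] at this
    rw [← this, hinv]
  have ibot : inv ⊥ = ⊤ := by
    apply top_le_iff.1
    have := hanti _ _ (bot_le : ⊥ ≤ inv ⊤)
    rwa [hinv] at this
  have itop : inv ⊤ = ⊥ := by rw [← ibot, hinv]
  have idist : ∀ a b c : α, a ⊓ (b ⊔ c) = (a ⊓ b) ⊔ (a ⊓ c) →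
      inv a ⊓ (inv b ⊔ inv c) = (inv a ⊓ inv b) ⊔ (inv a ⊓ inv c) := by
    intro a b c h
    apply ds_dual hm
    have := congrArg inv h
    simpa only [iinf, isup] using this
  constructor
  · rintro ⟨c1, c2, c3⟩
    have hz : inv x ⊓ (y ⊔ inv y) = (inv x ⊓ y) ⊔ (inv x ⊓ inv y) := by
      have := idist _ _ _ c1
      rwa [hinv, sup_comm (inv y), sup_comm (inv x ⊓ inv y)] at this
    have hw : inv y ⊓ (x ⊔ inv x) = (inv y ⊓ x) ⊔ (inv y ⊓ inv x) := by
      have := idist _ _ _ c2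
      rwa [hinv, sup_comm (inv x), sup_comm (inv y ⊓ inv x)] at this
    have hp : (x ⊓ inv x) ⊓ (y ⊔ inv y) = ((x ⊓ inv x) ⊓ y) ⊔ ((x ⊓ inv x) ⊓ inv y) := by
      rw [← c3]
      exact inf_eq_left.2 (hkle x y)
    have hp' : (x ⊔ inv x) ⊓ (y ⊔ inv y) = ((x ⊔ inv x) ⊓ y) ⊔ ((x ⊔ inv x) ⊓ inv y) := by
      have := idist _ _ _ hp
      rwa [iinf, hinv, hinv, sup_comm (inv x), sup_comm (inv y),
        sup_comm ((x ⊔ inv x) ⊓ inv y)] at this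
    have hq : (y ⊓ inv y) ⊓ (x ⊔ inv x) =
        ((y ⊓ inv y) ⊓ x) ⊔ ((y ⊓ inv y) ⊓ inv x) := by
      have t : x ⊓ (inv x ⊔ (y ⊓ inv y)) = (x ⊓ inv x) ⊔ (x ⊓ (y ⊓ inv y)) := by
        have t1 : x ⊓ (inv x ⊔ y) = (x ⊓ inv x) ⊔ (x ⊓ y) :=
          d_rot hm (d_rot hm (by rw [c2]))
        have t2 : x ⊓ (inv x ⊔ inv y) = (x ⊓ inv x) ⊔ (x ⊓ inv y) :=
          d_rot hm (d_rot hm hw)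
        have t3 : (x ⊓ inv x) ⊓ ((x ⊓ y) ⊔ (x ⊓ inv y)) =
            ((x ⊓ inv x) ⊓ (x ⊓ y)) ⊔ ((x ⊓ inv x) ⊓ (x ⊓ inv y)) := by
          have e : ∀ s, (x ⊓ inv x) ⊓ (x ⊓ s) = (x ⊓ inv x) ⊓ s := by
            intro s
            rw [← inf_assoc, inf_eq_left.2 (inf_le_left : x ⊓ inv x ≤ x)]
          rw [← c1, e, e, e, hp]
        rw [d_dual hm hz, inf_inf_distrib_left, t1, t2, ← d_dual hm t3,
          ← inf_inf_distrib_left]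
      exact d_rot hm t
    obtain ⟨K, g, mx, mz, my, mw⟩ := four_gen hm x (inv x) y (inv y) c2 hw hq c1 hz hp hp'
    refine ⟨{a | a ∈ K ∧ inv a ∈ K}, ⟨mx, mz⟩, ⟨my, mw⟩, ⟨g.bot, ?_⟩, ⟨g.top, ?_⟩,
      ?_, ?_, ?_, ?_⟩
    · rw [ibot]; exact g.top
    · rw [itop]; exact g.bot
    · rintro a ⟨h1, h2⟩ b ⟨h3, h4⟩
      exact ⟨g.inf _ h1 _ h3, by rw [iinf]; exact g.sup _ h2 _ h4⟩
    · rintro a ⟨h1, h2⟩ b ⟨h3, h4⟩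
      exact ⟨g.sup _ h1 _ h3, by rw [isup]; exact g.inf _ h2 _ h4⟩
    · rintro a ⟨h1, h2⟩
      exact ⟨h2, by rw [hinv]; exact h1⟩
    · rintro a ⟨h1, -⟩ b ⟨h2, -⟩ d ⟨h3, -⟩
      exact g.dist _ h1 _ h2 _ h3
  · rintro ⟨S, mx, my, -, -, hi, -, hn, hd⟩
    refine ⟨hd _ mx _ my _ (hn _ my), hd _ my _ mx _ (hn _ mx), ?_⟩
    rw [← hd _ (hi _ mx _ (hn _ mx)) _ my _ (hn _ my)]
    exact (inf_eq_left.2 (hkle x y)).symm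
end
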